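/- arXiv:1607.04911 — 5 statements merged into one kernel-verified Lean document; each statement's English description precedes it below -/
import Mathlib

section
/- There exist a constant c > 0 and N ∈ ℕ such that for every n ≥ N, every simple graph G with the property that for each ℓ with 3 ≤ ℓ ≤ n the cycle graph C_ℓ is an induced subgraph of G, has at least n + c·log(log n) vertices (log denoting logarithm base 2). -/
open Finset Fin.CommRing in
theorem aux_closed {p : ℕ} (D : Finset (Fin (p+3))) (v : Fin (p+3)) (hv : v ∈ D)
    (h : ∀ w ∈ D, w - 1 ∈ D) : D = univ := by
  have key : ∀ t : ℕ, v - (t : Fin (p+3)) ∈ D := by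
    intro t
    induction t with
    | zero => simpa using hv
    | succ t ih =>
      have := h _ ih
      rwa [sub_sub, ← Nat.cast_succ] at this
  ext w
  simp only [mem_univ, iff_true]
  have := key (v - w).val
  rw [Fin.cast_val_eq_self] at this
  simpa using this

open Finset in
theorem aux_nbr {V : Type} [Fintype V] [DecidableEq V] (G : SimpleGraph V) [DecidableRel G.Adj]
    {p : ℕ} (φ : SimpleGraph.cycleGraph (p+3) ↪g G) (X : Finset V)
    (hX : ∀ x ∈ X, #{y ∈ X | G.Adj x y} = 2) (v : Fin (p+3)) (hv : φ v ∈ X)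
    (hA : ∀ r ∈ X, r ∉ Finset.univ.image φ → ¬ G.Adj r (φ v)) :
    φ (v - 1) ∈ X ∧ φ (v + 1) ∈ X := by
  have hsub : ({y ∈ X | G.Adj (φ v) y} : Finset V) ⊆ {φ (v-1), φ (v+1)} := by
    intro y hy
    rw [mem_filter] at hy
    have h1 : y ∈ Finset.univ.image φ := by
      by_contra h
      exact hA y hy.1 h hy.2.symm
    obtain ⟨w, -, rfl⟩ := mem_image.1 h1
    have h2 := hy.2
    rw [φ.map_adj_iff, SimpleGraph.cycleGraph_adj] at h2
    simp only [mem_insert, mem_singleton]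
    rcases h2 with h2 | h2
    · left; congr 1; rw [← h2]; simp
    · right; congr 1; rw [← h2]; simp
  have heq := eq_of_subset_of_card_le hsub (by rw [hX _ hv]; exact card_le_two)
  constructor
  · have : φ (v-1) ∈ ({y ∈ X | G.Adj (φ v) y} : Finset V) := by rw [heq]; simp
    exact (mem_filter.1 this).1
  · have : φ (v+1) ∈ ({y ∈ X | G.Adj (φ v) y} : Finset V) := by rw [heq]; simp
    exact (mem_filter.1 this).1

open Finset in
theorem aux_sub {V : Type} [Fintype V] [DecidableEq V] (G : SimpleGraph V) [DecidableRel G.Adj]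
    {p : ℕ} (φ : SimpleGraph.cycleGraph (p+3) ↪g G) (X Y : Finset V)
    (hX : ∀ x ∈ X, #{y ∈ X | G.Adj x y} = 2) (hY : ∀ x ∈ Y, #{y ∈ Y | G.Adj x y} = 2)
    (hXc : #X < p + 3)
    (hT : ∀ r, r ∉ Finset.univ.image φ → (r ∈ X ↔ r ∈ Y))
    (hA : ∀ r ∈ X, r ∉ Finset.univ.image φ → ∀ v, G.Adj r (φ v) → (φ v ∈ X ↔ φ v ∈ Y))
    (hB : ∀ r ∈ X, r ∉ Finset.univ.image φ → ∀ v, G.Adj r (φ v) → φ v ∈ X →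
      (φ (v+1) ∈ X ↔ φ (v+1) ∈ Y)) : X ⊆ Y := by
  intro x hx
  by_cases hxR : x ∈ Finset.univ.image φ
  swap
  · exact (hT x hxR).1 hx
  obtain ⟨v, -, rfl⟩ := mem_image.1 hxR
  by_contra hxy
  have := aux_closed (univ.filter fun v => φ v ∈ X ∧ φ v ∉ Y) v (by simp [hx, hxy]) (by
    intro w hw
    simp only [mem_filter, mem_univ, true_and] at hw ⊢
    have h1 : φ (w - 1) ∈ X := (aux_nbr G φ X hX w hw.1 (fun r hr hr' ha =>
      hw.2 ((hA r hr hr' w ha).1 hw.1))).1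
    refine ⟨h1, fun h2 => ?_⟩
    by_cases h3 : ∃ r ∈ X, r ∉ Finset.univ.image φ ∧ G.Adj r (φ (w-1))
    · obtain ⟨r, hr, hr', ha⟩ := h3
      have := hB r hr hr' _ ha h1
      rw [sub_add_cancel] at this
      exact hw.2 (this.1 hw.1)
    · push Not at h3
      have := (aux_nbr G φ Y hY (w-1) h2 (fun r hr hr' => h3 r ((hT r hr').2 hr) hr')).2
      rw [sub_add_cancel] at this
      exact hw.2 this)
  have h2 : univ.image φ ⊆ X := by
    intro y hy
    obtain ⟨w, -, rfl⟩ := mem_image.1 hy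
    have : w ∈ (univ.filter fun v => φ v ∈ X ∧ φ v ∉ Y) := by rw [this]; simp
    exact (mem_filter.1 this).2.1
  have h3 := card_le_card h2
  rw [card_image_of_injective _ φ.injective] at h3
  simp at h3
  omega

open Finset in
theorem aux_P2 {α : Type} [DecidableEq α] (N : Finset α) :
    #{A ∈ N.powerset | #A ≤ 2} ≤ (#N + 1)^2 := by
  have : {A ∈ N.powerset | #A ≤ 2} ⊆
      (N.powersetCard 0 ∪ N.powersetCard 1) ∪ N.powersetCard 2 := by
    intro A hA
    simp only [mem_filter, mem_powerset] at hA
    simp only [mem_union, mem_powersetCard]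
    have : #A = 0 ∨ #A = 1 ∨ #A = 2 := by omega
    tauto
  have h1 := (card_le_card this).trans (card_union_le _ _)
  have h2 := card_union_le (N.powersetCard 0) (N.powersetCard 1)
  simp only [card_powersetCard] at h1 h2
  have h3 : (#N).choose 2 ≤ #N ^ 2 := Nat.choose_le_pow _ _
  simp at h1 h2
  nlinarith

open Finset in
theorem aux_count {V : Type} [Fintype V] [DecidableEq V] (G : SimpleGraph V) [DecidableRel G.Adj]
    {p : ℕ} (φ : SimpleGraph.cycleGraph (p+3) ↪g G) (k m : ℕ) (hk : Fintype.card V = p + 3 + k)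
    (hm : m ≤ p) (X : ℕ → Finset V)
    (hX : ∀ l, 3 ≤ l → l ≤ p + 3 → ∀ x ∈ X l, #{y ∈ X l | G.Adj x y} = 2)
    (hXc : ∀ l, 3 ≤ l → l ≤ p + 3 → #(X l) = l) :
    m ≤ ∏ r ∈ (univ \ univ.image φ).filter (fun r => #{i | G.Adj r (φ i)} + 2 ≤ m + k + 4),
      (#{i | G.Adj r (φ i)} + 2)^5 := by
  set N : V → Finset (Fin (p+3)) := fun r => ({i | G.Adj r (φ i)} : Finset (Fin (p+3))) with hN
  set R := (univ \ univ.image φ) with hR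
  have hRc : #R = k := by
    rw [hR, card_sdiff_of_subset (subset_univ _), card_image_of_injective _ φ.injective]
    simp [hk]
  let P2 : V → Finset (Finset (Fin (p+3))) := fun r => {A ∈ (N r).powerset | #A ≤ 2}
  let good : V → Prop := fun r => r ∈ R ∧ #(N r) + 2 ≤ m + k + 4
  let tgt : V → Finset (Bool × Finset (Fin (p+3)) × Finset (Fin (p+3))) := fun r =>
    if good r then univ ×ˢ P2 r ×ˢ P2 r else {(false, ∅, ∅)}
  let A : ℕ → V → Finset (Fin (p+3)) := fun l r =>
    (N r).filter fun i => r ∈ R ∧ r ∈ X l ∧ φ i ∈ X l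
  let B : ℕ → V → Finset (Fin (p+3)) := fun l r => (A l r).filter fun i => φ (i+1) ∈ X l
  let data : ℕ → V → (Bool × Finset (Fin (p+3)) × Finset (Fin (p+3))) := fun l r =>
    (decide (r ∈ R ∧ r ∈ X l), A l r, B l r)
  have hA2 : ∀ l ∈ Ico (p+3-m) (p+3), ∀ r, #(A l r) ≤ 2 := by
    intro l hl r
    rw [mem_Ico] at hl
    by_cases hr : r ∈ X l
    · rw [← hX l (by omega) (by omega) r hr]
      rw [← card_image_of_injective (A l r) φ.injective]
      apply card_le_card
      intro y hy
      obtain ⟨i, hi, rfl⟩ := mem_image.1 hy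
      simp only [A, hN, mem_filter, mem_univ, true_and] at hi ⊢
      tauto
    · simp [A, hr]
  have hmaps : ∀ l ∈ Ico (p+3-m) (p+3), data l ∈ Fintype.piFinset tgt := by
    intro l hl
    rw [Fintype.mem_piFinset]
    intro r
    by_cases hg : good r
    · simp only [tgt, hg, if_true, data, mem_product, mem_univ, true_and, P2, mem_filter,
        mem_powerset]
      refine ⟨⟨filter_subset _ _, hA2 l hl r⟩,
        (filter_subset _ _).trans (filter_subset _ _), (card_filter_le _ _).trans (hA2 l hl r)⟩
    · simp only [tgt, hg, if_false, mem_singleton]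
      have hnot : ¬ (r ∈ R ∧ r ∈ X l) := by
        rintro ⟨hr, hrX⟩
        apply hg
        refine ⟨hr, ?_⟩
        have h2 := hA2 l hl r
        rw [mem_Ico] at hl
        have hc := hXc l (by omega) (by omega)
        let P : Finset (Fin (p+3)) := univ.filter fun i => φ i ∈ X l
        have h3 : X l ⊆ P.image φ ∪ R := by
          intro x hx
          by_cases hxR : x ∈ R
          · exact mem_union_right _ hxR
          · apply mem_union_left
            have : x ∈ univ.image φ := by simpa [hR] using hxR
            obtain ⟨i, -, rfl⟩ := mem_image.1 this
            exact mem_image_of_mem _ (by simp [P, hx])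
        have h4 := (card_le_card h3).trans (card_union_le _ _)
        have h5 : N r ⊆ A l r ∪ Pᶜ := by
          intro i hi
          by_cases h : φ i ∈ X l
          · apply mem_union_left
            simp only [A, mem_filter]
            exact ⟨hi, hr, hrX, h⟩
          · apply mem_union_right
            simp [P, h]
        have h6 := (card_le_card h5).trans (card_union_le _ _)
        have h7 : #P ≤ p + 3 := by simpa using card_le_univ P
        rw [card_image_of_injective _ φ.injective] at h4
        rw [card_compl, Fintype.card_fin] at h6
        omega
      have hA0 : A l r = ∅ := by
        simp only [A, filter_eq_empty_iff]
        tauto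
      simp only [data, B, hA0, filter_empty, decide_eq_false hnot]
  have hsub : ∀ l ∈ Ico (p+3-m) (p+3), ∀ l' ∈ Ico (p+3-m) (p+3), data l = data l' →
      X l ⊆ X l' := by
    intro l hl l' hl' h
    rw [mem_Ico] at hl hl'
    have e0 : ∀ r, r ∉ univ.image φ → r ∈ R := fun r hr => by simpa [hR] using hr
    have e1 : ∀ r ∈ R, (r ∈ X l ↔ r ∈ X l') := by
      intro r hr
      have := congrArg Prod.fst (congrFun h r)
      simpa [data, hr] using this
    have e2 : ∀ r, A l r = A l' r := fun r => congrArg (fun z => z.2.1) (congrFun h r)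
    have e3 : ∀ r, B l r = B l' r := fun r => congrArg (fun z => z.2.2) (congrFun h r)
    have e4 : ∀ r ∈ X l, r ∉ Finset.univ.image φ → ∀ v, G.Adj r (φ v) →
        (φ v ∈ X l ↔ φ v ∈ X l') := by
      intro r hr hr' v ha
      have h1 := e2 r
      have h2 := e0 r hr'
      have h3 := (e1 r h2).1 hr
      have h4 := Finset.ext_iff.1 h1 v
      simpa [A, hN, h2, h3, hr, ha] using h4
    refine aux_sub G φ (X l) (X l') (hX l (by omega) (by omega)) (hX l' (by omega) (by omega))
      (by rw [hXc l (by omega) (by omega)]; omega) (fun r hr => e1 r (e0 r hr)) e4 ?_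
    intro r hr hr' v ha hv
    have h2 := e0 r hr'
    have h3 := (e1 r h2).1 hr
    have h4 := Finset.ext_iff.1 (e3 r) v
    have h5 := (e4 r hr hr' v ha).1 hv
    simpa [B, A, hN, h2, h3, hr, ha, hv, h5] using h4
  have hinj : Set.InjOn data (Ico (p+3-m) (p+3) : Finset ℕ) := by
    intro l hl l' hl' h
    rw [mem_coe] at hl hl'
    have := Subset.antisymm (hsub l hl l' hl' h) (hsub l' hl' l hl h.symm)
    have h2 := congrArg card this
    rw [mem_Ico] at hl hl'
    rwa [hXc l (by omega) (by omega), hXc l' (by omega) (by omega)] at h2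
  have hcard := card_le_card_of_injOn data (fun l hl => hmaps l hl) hinj
  rw [Nat.card_Ico, Fintype.card_piFinset] at hcard
  have hm' : p + 3 - (p + 3 - m) = m := by omega
  rw [hm'] at hcard
  refine hcard.trans ?_
  have hf : (R.filter (fun r => #(N r) + 2 ≤ m + k + 4)) = univ.filter good := by
    ext r; simp [good]
  rw [hf, prod_filter]
  apply prod_le_prod'
  intro r _
  by_cases hg : good r
  · rw [if_pos hg]
    simp only [tgt, hg, if_true, card_product]
    have h1 : #(P2 r) ≤ (#(N r) + 1)^2 := aux_P2 (N r)
    have h2 : #(univ : Finset Bool) = 2 := rfl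
    rw [h2]
    calc 2 * (#(P2 r) * #(P2 r)) ≤ (#(N r) + 2) * ((#(N r) + 2)^2 * (#(N r) + 2)^2) := by
          have h3 : #(P2 r) ≤ (#(N r) + 2)^2 := h1.trans (by gcongr; omega)
          gcongr
          omega
      _ = _ := by ring
  · rw [if_neg hg]
    simp only [tgt, hg, if_false, card_singleton, le_refl]

open Finset in
theorem aux_arith {α : Type} [DecidableEq α] (R : Finset α) (e : α → ℕ) (he : ∀ r, 1 ≤ e r)
    (p k : ℕ) (hk : #R = k)
    (h : ∀ m ≤ p, m ≤ ∏ r ∈ R.filter (fun r => e r ≤ m + k + 4), (e r)^5) :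
    p < (k+6)^(7^(k+1)) := by
  by_contra! hp
  have key : ∀ j ≤ k + 1, ∃ Q ⊆ R, #Q = j ∧ ∏ r ∈ Q, e r ≤ (k+6)^(7^j) := by
    intro j
    induction j with
    | zero => intro _; exact ⟨∅, by simp, by simp, by simp⟩
    | succ j ih =>
      intro hj
      obtain ⟨Q, hQR, hQ, hprod⟩ := ih (by omega)
      set W := (k+6)^(7^j) with hW
      have hW7 : (k+6)^(7^(j+1)) = W^7 := by rw [hW, ← pow_mul, pow_succ]
      have hWk : k + 6 ≤ W := Nat.le_self_pow (by positivity) _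
      have hstep : W^5 + 1 + k + 4 ≤ W^6 := by
        have : 1 ≤ W^5 := Nat.one_le_pow _ _ (by omega)
        have h2 : W ≤ W^5 := Nat.le_self_pow (by norm_num) _
        have h3 : W^6 = W^5 * W := by ring
        nlinarith
      have hle : W^7 ≤ (k+6)^(7^(k+1)) := by
        rw [← hW7]
        exact Nat.pow_le_pow_right (by omega) (Nat.pow_le_pow_right (by omega) hj)
      have h67 : W^6 ≤ W^7 := Nat.pow_le_pow_right (by omega) (by omega)
      have hm := h (W^5+1) (by omega)
      have : ∃ r ∈ R.filter (fun r => e r ≤ W^5+1 + k + 4), r ∉ Q := by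
        by_contra! hcon
        have h1 : ∏ r ∈ R.filter (fun r => e r ≤ W^5+1 + k + 4), (e r)^5 ≤ ∏ r ∈ Q, (e r)^5 :=
          prod_le_prod_of_subset_of_one_le' hcon (fun r _ _ => Nat.one_le_pow _ _ (he r))
        rw [prod_pow Q] at h1
        have h2 := Nat.pow_le_pow_left hprod 5
        omega
      obtain ⟨r, hr, hrQ⟩ := this
      rw [mem_filter] at hr
      refine ⟨insert r Q, insert_subset hr.1 hQR, by rw [card_insert_of_notMem hrQ, hQ], ?_⟩
      rw [prod_insert hrQ, hW7]
      calc e r * ∏ r ∈ Q, e r ≤ W^6 * W := Nat.mul_le_mul (hr.2.trans hstep) hprod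
        _ = W^7 := by ring
  obtain ⟨Q, hQR, hQ, -⟩ := key (k+1) le_rfl
  have := card_le_card hQR
  omega

theorem aux_bound (k : ℕ) : (k+6)^(7^(k+1)) + 3 ≤ 2^(2^(4*k+7)) := by
  have h1 : k + 6 ≤ 2^(k+3) := by
    have := Nat.lt_two_pow_self (n := k)
    rw [pow_add]; omega
  have h2 : (7:ℕ)^(k+1) ≤ 2^(3*(k+1)) := by
    rw [pow_mul]; exact Nat.pow_le_pow_left (by norm_num) _
  have h3 : k + 3 ≤ 2^(k+3) := Nat.lt_two_pow_self.le
  have h4 : (k+6)^(7^(k+1)) ≤ 2^(2^(4*k+6)) := by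
    calc (k+6)^(7^(k+1)) ≤ (2^(k+3))^(7^(k+1)) := Nat.pow_le_pow_left h1 _
      _ = 2^((k+3)*7^(k+1)) := by rw [pow_mul]
      _ ≤ 2^(2^(k+3) * 2^(3*(k+1))) := Nat.pow_le_pow_right (by norm_num) (Nat.mul_le_mul h3 h2)
      _ = _ := by rw [← pow_add]; congr 2; ring
  have h5 : 2^(2^(4*k+7)) = 2^(2^(4*k+6)) * 2^(2^(4*k+6)) := by
    rw [← pow_add]; congr 1; ring
  have h6 : 4 ≤ 2^(2^(4*k+6)) := by
    calc 4 = 2^2 := by norm_num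
      _ ≤ _ := Nat.pow_le_pow_right (by norm_num) (Nat.le_self_pow (by omega) 2)
  rw [h5]
  nlinarith

open Finset in
theorem aux_main (p : ℕ) (V : Type) [Fintype V] (G : SimpleGraph V)
    (h : ∀ ℓ : ℕ, 3 ≤ ℓ → ℓ ≤ p + 3 → Nonempty (SimpleGraph.cycleGraph ℓ ↪g G)) :
    ∃ k, Fintype.card V = p + 3 + k ∧ p + 3 < 2^(2^(4*k+7)) := by
  classical
  obtain ⟨φ⟩ := h (p+3) (by omega) le_rfl
  have hc : p + 3 ≤ Fintype.card V := by
    simpa using Fintype.card_le_of_injective φ φ.injective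
  obtain ⟨k, hk⟩ := Nat.exists_eq_add_of_le hc
  refine ⟨k, hk, ?_⟩
  have hex : ∀ l, ∃ X : Finset V, 3 ≤ l → l ≤ p + 3 →
      (∀ x ∈ X, #{y ∈ X | G.Adj x y} = 2) ∧ #X = l := by
    intro l
    by_cases hl : 3 ≤ l ∧ l ≤ p + 3
    swap
    · exact ⟨∅, fun h1 h2 => absurd ⟨h1, h2⟩ hl⟩
    obtain ⟨q, rfl⟩ := Nat.exists_eq_add_of_le' hl.1
    obtain ⟨ψ⟩ := h _ hl.1 hl.2
    refine ⟨univ.image ψ, fun _ _ => ⟨?_, ?_⟩⟩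
    · intro x hx
      obtain ⟨i, -, rfl⟩ := mem_image.1 hx
      have hd := SimpleGraph.cycleGraph_degree_three_le (n := q) (v := i)
      rw [← hd, ← SimpleGraph.card_neighborFinset_eq_degree,
        ← card_image_of_injective _ ψ.injective]
      congr 1
      ext y
      simp only [mem_filter, mem_image, mem_univ, true_and, SimpleGraph.mem_neighborFinset]
      constructor
      · rintro ⟨⟨j, rfl⟩, ha⟩
        exact ⟨j, ψ.map_adj_iff.1 ha, rfl⟩
      · rintro ⟨j, ha, rfl⟩
        exact ⟨⟨j, rfl⟩, ψ.map_adj_iff.2 ha⟩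
    · rw [card_image_of_injective _ ψ.injective]; simp
  choose X hX using hex
  have hRc : #(univ \ univ.image φ) = k := by
    rw [card_sdiff_of_subset (subset_univ _), card_image_of_injective _ φ.injective]
    simp [hk]
  have := aux_arith (univ \ univ.image φ) (fun r => #{i | G.Adj r (φ i)} + 2) (fun r => by omega)
    p k hRc (fun m hm => aux_count G φ k m hk hm X (fun l h1 h2 => (hX l h1 h2).1)
      (fun l h1 h2 => (hX l h1 h2).2))
  have := aux_bound k
  omega

/-- There are `c > 0` and `N` such that for every `n ≥ N`, every graph that
contains, for each `3 ≤ ℓ ≤ n`, the cycle of length `ℓ` as an induced subgraph has at least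
`n + c · log (log n)` vertices (logarithms base 2). -/
theorem statement15 :
    ∃ c : ℝ, 0 < c ∧ ∃ N : ℕ, ∀ n : ℕ, N ≤ n →
      ∀ (V : Type) (_ : Fintype V) (G : SimpleGraph V),
        (∀ ℓ : ℕ, 3 ≤ ℓ → ℓ ≤ n → Nonempty (SimpleGraph.cycleGraph ℓ ↪g G)) →
        (n : ℝ) + c * Real.logb 2 (Real.logb 2 n) ≤ (Fintype.card V : ℝ) := by
  obtain ⟨N, hN⟩ : ∃ N : ℕ, N = 2^(2^14) := ⟨_, rfl⟩
  refine ⟨1/8, by norm_num, N + 3, ?_⟩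
  intro n hn V _ G h
  obtain ⟨p, rfl⟩ := Nat.exists_eq_add_of_le' (show 3 ≤ n by omega)
  obtain ⟨k, hk, hlt⟩ := aux_main p V G h
  set n := p + 3
  have hk2 : 2 ≤ k := by
    by_contra! hk2
    have h1 : 2^(2^(4*k+7)) ≤ N := by
      rw [hN]
      exact Nat.pow_le_pow_right (by norm_num) (Nat.pow_le_pow_right (by norm_num) (by omega))
    omega
  have hn3 : (3:ℝ) ≤ n := by
    have : 3 ≤ n := by omega
    exact_mod_cast this
  have hlog1 : Real.logb 2 n ≤ 2^(4*k+7) := by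
    rw [Real.logb_le_iff_le_rpow (by norm_num) (by linarith)]
    have : (n:ℝ) ≤ 2^(2^(4*k+7)) := by exact_mod_cast hlt.le
    calc (n:ℝ) ≤ 2^(2^(4*k+7)) := this
      _ = _ := by rw [← Real.rpow_natCast]; norm_cast
  have hpos : 0 < Real.logb 2 n := Real.logb_pos (by norm_num) (by linarith)
  have hlog2 : Real.logb 2 (Real.logb 2 n) ≤ 4*k+7 := by
    rw [Real.logb_le_iff_le_rpow (by norm_num) hpos]
    calc Real.logb 2 n ≤ 2^(4*k+7) := hlog1
      _ = _ := by rw [← Real.rpow_natCast]; norm_cast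
  have hk2' : (2:ℝ) ≤ k := by exact_mod_cast hk2
  rw [hk]
  push_cast
  linarith
end

section
/- Let G_3, G_4, G_5, … be an infinite family of simple graphs such that for every i ≥ 3 and every ℓ with 3 ≤ ℓ ≤ i, the cycle graph C_ℓ is an induced subgraph of G_i, and such that G_i is an induced subgraph of G_{i+1} for every i ≥ 3. Then there exists a constant c > 0 such that for every N there exists n ≥ N with |V(G_n)| ≥ n + c·n^{1/3} (as real numbers). -/
open Finset in
open Classical in
theorem aux_chain (V : ℕ → Type) (inst : ∀ i, Fintype (V i))
    (G : ∀ i, SimpleGraph (V i))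
    (hcyc : ∀ i : ℕ, 3 ≤ i → ∀ ℓ : ℕ, 3 ≤ ℓ → ℓ ≤ i →
      Nonempty (SimpleGraph.cycleGraph ℓ ↪g G i))
    (hmono : ∀ i : ℕ, 3 ≤ i → Nonempty (G i ↪g G (i + 1))) (n : ℕ) (hn : 3 ≤ n) (d : ℕ) :
    ∃ (A C : ℕ → Finset (V (n + d))) (φ : SimpleGraph.cycleGraph (n + d) ↪g G (n + d)),
      C (n + d) = univ.map φ.toEmbedding ∧
      (∀ ℓ, n ≤ ℓ → ℓ ≤ n + d → C ℓ ⊆ A ℓ ∧ #(C ℓ) = ℓ ∧ #(A ℓ) = Fintype.card (V ℓ) ∧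
        ∀ x ∈ C ℓ, #{y ∈ C ℓ | (G (n + d)).Adj x y} = 2) ∧
      (∀ ℓ, n ≤ ℓ → ℓ < n + d → A ℓ ⊆ A (ℓ + 1)) := by
  have top : ∀ m, 3 ≤ m → ∀ φ : SimpleGraph.cycleGraph m ↪g G m, 
      #(univ.map φ.toEmbedding) = m ∧ 
      ∀ x ∈ univ.map φ.toEmbedding, #{y ∈ univ.map φ.toEmbedding | (G m).Adj x y} = 2 := by
    intro m hm φ
    refine ⟨by simp, ?_⟩
    intro x hx
    simp only [mem_map, mem_univ, true_and] at hx
    obtain ⟨i, rfl⟩ := hx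
    obtain ⟨p, rfl⟩ : ∃ p, m = p + 3 := ⟨m - 3, by omega⟩
    have h := SimpleGraph.cycleGraph_degree_three_le (n := p) (v := i)
    rw [← SimpleGraph.card_neighborFinset_eq_degree] at h
    rw [← h, ← card_map φ.toEmbedding]
    congr 1
    ext y
    simp only [mem_filter, mem_map, mem_univ, true_and, SimpleGraph.mem_neighborFinset]
    constructor
    · rintro ⟨⟨j, rfl⟩, h⟩
      exact ⟨j, φ.map_rel_iff.1 h, rfl⟩
    · rintro ⟨j, h, rfl⟩
      exact ⟨⟨j, rfl⟩, φ.map_rel_iff.2 h⟩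
  induction d with
  | zero =>
    obtain ⟨φ⟩ := hcyc n hn n hn le_rfl
    refine ⟨fun _ => univ, fun _ => univ.map φ.toEmbedding, φ, rfl, ?_, ?_⟩
    · intro ℓ h1 h2
      obtain rfl : ℓ = n := by simp at h2; omega
      exact ⟨subset_univ _, (top _ hn φ).1, card_univ, (top _ hn φ).2⟩
    · intro ℓ h1 h2; simp at h2; omega
  | succ d ih =>
    obtain ⟨A, C, -, -, h1, h2⟩ := ih
    obtain ⟨φ⟩ := hcyc (n + (d + 1)) (by omega) (n + (d + 1)) (by omega) le_rfl
    obtain ⟨s⟩ := hmono (n + d) (by omega)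
    change G (n + d) ↪g G (n + (d + 1)) at s
    refine ⟨fun ℓ => if ℓ = n + (d + 1) then univ else (A ℓ).map s.toEmbedding,
      fun ℓ => if ℓ = n + (d + 1) then univ.map φ.toEmbedding else (C ℓ).map s.toEmbedding,
      φ, by simp, ?_, ?_⟩
    · intro ℓ h3 h4
      by_cases h : ℓ = n + (d + 1)
      · subst h
        simp only [if_true]
        exact ⟨subset_univ _, (top _ (by omega) φ).1, card_univ, (top _ (by omega) φ).2⟩
      · simp only [h, if_false]
        obtain ⟨a, b, c, e⟩ := h1 ℓ h3 (by omega)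
        refine ⟨map_subset_map.2 a, by rw [card_map, b], by rw [card_map, c], ?_⟩
        intro x hx
        obtain ⟨z, hz, rfl⟩ := mem_map.1 hx
        rw [← e z hz, ← card_map s.toEmbedding]
        congr 1
        ext y
        simp only [mem_filter, mem_map]
        constructor
        · rintro ⟨⟨j, hj, rfl⟩, h⟩
          exact ⟨j, ⟨hj, s.map_rel_iff.1 h⟩, rfl⟩
        · rintro ⟨j, ⟨hj, h⟩, rfl⟩
          exact ⟨⟨j, hj, rfl⟩, s.map_rel_iff.2 h⟩
    · intro ℓ h3 h4
      have h5 : ℓ ≠ n + (d + 1) := by omega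
      by_cases h : ℓ + 1 = n + (d + 1)
      · simp [h]
      · simp only [h, h5, if_false]
        exact map_subset_map.2 (h2 ℓ h3 (by omega))

open Finset in
open Classical in
open Fin.CommRing in
theorem aux_count_s16 {W : Type} [Fintype W] (H : SimpleGraph W) (n p k : ℕ)
    (hnm : n ≤ p + 3) (hk : k + 2 ≤ p + 3)
    (A C : ℕ → Finset W) (φ : SimpleGraph.cycleGraph (p + 3) ↪g H)
    (hφ : C (p + 3) = univ.map φ.toEmbedding)
    (h1 : ∀ ℓ, n ≤ ℓ → ℓ ≤ p + 3 → C ℓ ⊆ A ℓ ∧ #(C ℓ) = ℓ ∧ #(A ℓ) ≤ ℓ + k ∧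
        ∀ x ∈ C ℓ, #{y ∈ C ℓ | H.Adj x y} = 2)
    (h2 : ∀ ℓ, n ≤ ℓ → ℓ < p + 3 → A ℓ ⊆ A (ℓ + 1))
    (hW : Fintype.card W ≤ p + 3 + k) :
    p + 3 ≤ n + (k + 2) * (k * (k + 2)) := by
  have hA : ∀ a b, n ≤ a → a ≤ b → b ≤ p + 3 → A a ⊆ A b := by
    intro a b ha hab
    induction b, hab using Nat.le_induction with
    | base => intro _; exact Subset.rfl
    | succ b hb ih => intro h; exact (ih (by omega)).trans (h2 b (by omega) (by omega))
  set Z := C (p + 3) with hZ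
  set X := Zᶜ with hX
  have hXc : #X ≤ k := by
    rw [hX, card_compl, (h1 (p+3) hnm le_rfl).2.1]; omega
  let Mx : W → Finset W := fun x =>
    {v | ∃ ℓ, n ≤ ℓ ∧ ℓ ≤ p + 3 ∧ x ∈ C ℓ ∧ v ∈ C ℓ ∧ H.Adj x v}
  have hMx : ∀ x, #(Mx x) ≤ k + 2 := by
    intro x
    by_cases hx : ∃ ℓ, ℓ ≤ p + 3 ∧ n ≤ ℓ ∧ x ∈ C ℓ
    · let L := Nat.findGreatest (fun ℓ => n ≤ ℓ ∧ x ∈ C ℓ) (p + 3)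
      have hL : n ≤ L ∧ x ∈ C L := by
        obtain ⟨ℓ, a, b⟩ := hx
        exact Nat.findGreatest_spec (P := fun ℓ => n ≤ ℓ ∧ x ∈ C ℓ) a b
      have hLp : L ≤ p + 3 := Nat.findGreatest_le _
      obtain ⟨c1, c2, c3, c4⟩ := h1 L hL.1 hLp
      have hsub : Mx x ⊆ (A L \ C L) ∪ {y ∈ C L | H.Adj x y} := by
        intro v hv
        simp only [Mx, mem_filter, mem_univ, true_and] at hv
        obtain ⟨ℓ, a, b, c, d, e⟩ := hv
        have hle : ℓ ≤ L := Nat.le_findGreatest b ⟨a, c⟩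
        have hvA : v ∈ A L := hA ℓ L a hle hLp ((h1 ℓ a b).1 d)
        simp only [mem_union, mem_sdiff, mem_filter]
        tauto
      calc #(Mx x) ≤ _ := card_le_card hsub
        _ ≤ _ := card_union_le _ _
        _ ≤ k + 2 := by
          rw [c4 x hL.2, card_sdiff_of_subset c1]; omega
    · have : Mx x = ∅ := by
        apply filter_eq_empty_iff.2
        rintro v - ⟨ℓ, a, b, c, d, e⟩
        exact hx ⟨ℓ, b, a, c⟩
      rw [this]; simp
  set M := X.biUnion Mx with hM
  have hMc : #M ≤ k * (k + 2) :=
    (card_biUnion_le_card_mul _ _ _ (fun x _ => hMx x)).trans (Nat.mul_le_mul_right _ hXc)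
  have hZmem : ∀ i, φ i ∈ Z := by
    intro i; rw [hφ]; exact mem_map_of_mem _ (mem_univ i)
  -- unmarked vertices keep all of their cycle neighbours
  have key : ∀ ℓ, n ≤ ℓ → ℓ ≤ p + 3 → ∀ i j, φ i ∉ M → φ i ∈ C ℓ →
      (SimpleGraph.cycleGraph (p + 3)).Adj i j → φ j ∈ C ℓ := by
    intro ℓ a b i j hiM hi hij
    have hs : ({y ∈ C ℓ | H.Adj (φ i) y} : Finset W) ⊆ {y ∈ Z | H.Adj (φ i) y} := by
      intro y hy
      simp only [mem_filter] at hy ⊢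
      refine ⟨?_, hy.2⟩
      by_contra hyZ
      apply hiM
      rw [hM, mem_biUnion]
      refine ⟨y, by simp [hX, hyZ], ?_⟩
      simp only [Mx, mem_filter, mem_univ, true_and]
      exact ⟨ℓ, a, b, hy.1, hi, hy.2.symm⟩
    have he := eq_of_subset_of_card_le hs (by
      rw [(h1 ℓ a b).2.2.2 _ hi, (h1 (p+3) hnm le_rfl).2.2.2 _ (hZmem i)])
    have : φ j ∈ ({y ∈ Z | H.Adj (φ i) y} : Finset W) := by
      simp only [mem_filter]
      exact ⟨hZmem j, φ.map_rel_iff.2 hij⟩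
    rw [← he] at this
    exact (mem_filter.1 this).1
  have adj : ∀ i : Fin (p + 3), (SimpleGraph.cycleGraph (p + 3)).Adj i (i + 1) := by
    intro i
    rw [SimpleGraph.cycleGraph_adj]
    right; simp
  -- windows
  have win : ∀ i : Fin (p + 3), (∀ j : ℕ, j < k + 2 → φ (i + (j : Fin (p + 3))) ∉ M) →
      ∀ ℓ, ℓ ≤ p + 3 → n ≤ ℓ → ∀ j : ℕ, j < k + 2 → φ (i + (j : Fin (p + 3))) ∈ C ℓ := by
    intro i hi ℓ hℓ
    induction hℓ using Nat.decreasingInduction with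
    | self => intro _ j _; exact hZmem _
    | of_succ ℓ hℓ ih =>
      intro hnℓ
      have ih := ih (by omega)
      have heq : ∀ j : ℕ, j < k + 2 →
          (φ (i + (j : Fin (p + 3))) ∈ C ℓ ↔ φ (i + ((0 : ℕ) : Fin (p + 3))) ∈ C ℓ) := by
        intro j
        induction j with
        | zero => intro _; rfl
        | succ j ihj =>
          intro hj
          rw [← ihj (by omega)]
          have ha := adj (i + (j : Fin (p + 3)))
          have hc : i + (j : Fin (p + 3)) + 1 = i + ((j + 1 : ℕ) : Fin (p + 3)) := by
            push_cast; ring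
          rw [hc] at ha
          exact ⟨fun h => key ℓ hnℓ (by omega) _ _ (hi _ hj) h ha.symm,
            fun h => key ℓ hnℓ (by omega) _ _ (hi _ (by omega)) h ha⟩
      by_contra hcon
      push Not at hcon
      obtain ⟨j, hj, hjC⟩ := hcon
      have h0 := fun h => hjC ((heq j hj).2 h)
      have hsub : (range (k + 2)).image (fun j : ℕ => φ (i + (j : Fin (p + 3)))) ⊆
          C (ℓ + 1) \ C ℓ := by
        intro y hy
        obtain ⟨j, hj, rfl⟩ := mem_image.1 hy
        have hj := mem_range.1 hj
        exact mem_sdiff.2 ⟨ih j hj, fun h => h0 ((heq j hj).1 h)⟩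
      have hc1 := card_le_card hsub
      rw [card_image_of_injOn, card_range] at hc1
      · have hd : C (ℓ + 1) \ C ℓ ⊆ A (ℓ + 1) \ C ℓ :=
          sdiff_subset_sdiff (h1 (ℓ + 1) (by omega) (by omega)).1 Subset.rfl
        have hd := card_le_card hd
        rw [card_sdiff_of_subset ((h1 ℓ hnℓ (by omega)).1.trans (h2 ℓ hnℓ (by omega)))] at hd
        have e1 := (h1 ℓ hnℓ (by omega)).2.1
        have e2 := (h1 (ℓ + 1) (by omega) (by omega)).2.2.1
        omega
      · intro a ha b hb hab
        have hab := add_left_cancel (φ.injective hab)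
        have ha := mem_range.1 (mem_coe.1 ha)
        have hb := mem_range.1 (mem_coe.1 hb)
        have := congrArg Fin.val hab
        rw [Fin.val_natCast, Fin.val_natCast, Nat.mod_eq_of_lt (by omega),
          Nat.mod_eq_of_lt (by omega)] at this
        exact this
  have hfin : Z \ C n ⊆ (range (k + 2)).biUnion (fun j : ℕ =>
      ({i : Fin (p + 3) | φ (i + (j : Fin (p + 3))) ∈ M} : Finset _).map φ.toEmbedding) := by
    intro y hy
    obtain ⟨hy1, hy2⟩ := mem_sdiff.1 hy
    rw [hφ] at hy1
    obtain ⟨i, -, rfl⟩ := mem_map.1 hy1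
    by_contra hcon
    apply hy2
    have := win i (by
      intro j hj hjM
      apply hcon
      refine mem_biUnion.2 ⟨j, mem_range.2 hj, mem_map_of_mem _ ?_⟩
      simpa using hjM) n hnm le_rfl 0 (by omega)
    simpa using this
  have hcard : #(Z \ C n) ≤ (k + 2) * (k * (k + 2)) := by
    refine (card_le_card hfin).trans ?_
    refine (card_biUnion_le_card_mul _ _ (k * (k + 2)) ?_).trans (by rw [card_range])
    intro j _
    rw [card_map]
    refine le_trans ?_ hMc
    apply card_le_card_of_injOn (fun i => φ (i + (j : Fin (p + 3))))
    · intro i hi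
      simpa using hi
    · intro a _ b _ hab
      exact add_right_cancel (φ.injective hab)
  have h3 := le_card_sdiff (C n) Z
  rw [(h1 n le_rfl hnm).2.1, (h1 (p+3) hnm le_rfl).2.1] at h3
  omega

/-- If `G_3, G_4, …` is a family of graphs such that `G_i` contains the
cycle of every length `3 ≤ ℓ ≤ i` as an induced subgraph, and `G_i` is an induced subgraph of
`G_{i+1}`, then there is `c > 0` such that for every `N` there exists `n ≥ N` with
`|V(G_n)| ≥ n + c · n^(1/3)`. -/
theorem statement16 (V : ℕ → Type) (inst : ∀ i, Fintype (V i))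
    (G : ∀ i, SimpleGraph (V i))
    (hcyc : ∀ i : ℕ, 3 ≤ i → ∀ ℓ : ℕ, 3 ≤ ℓ → ℓ ≤ i →
      Nonempty (SimpleGraph.cycleGraph ℓ ↪g G i))
    (hmono : ∀ i : ℕ, 3 ≤ i → Nonempty (G i ↪g G (i + 1))) :
    ∃ c : ℝ, 0 < c ∧ ∀ N : ℕ, ∃ n : ℕ, N ≤ n ∧
      (n : ℝ) + c * (n : ℝ) ^ ((1 : ℝ) / 3) ≤ (Fintype.card (V n) : ℝ) := by
  refine ⟨1 / 2, by norm_num, ?_⟩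
  by_contra hcon
  push Not at hcon
  obtain ⟨N, hN⟩ := hcon
  obtain ⟨t, ht3, htN⟩ : ∃ t : ℕ, 3 ≤ t ∧ N ≤ t := ⟨max 3 N, le_max_left _ _, le_max_right _ _⟩
  have hpow : t ≤ t ^ 3 := Nat.le_self_pow (by norm_num) t
  have hcard : ∀ ℓ, 4 * t ^ 3 ≤ ℓ → ℓ ≤ 8 * t ^ 3 → Fintype.card (V ℓ) ≤ ℓ + t := by
    intro ℓ a b
    have h := hN ℓ (by omega)
    have hb : (ℓ : ℝ) ^ ((1 : ℝ) / 3) ≤ 2 * t := by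
      have hb' : (ℓ : ℝ) ≤ (2 * (t : ℝ)) ^ (3 : ℕ) := by
        have : (ℓ : ℝ) ≤ 8 * (t : ℝ) ^ 3 := by exact_mod_cast b
        nlinarith
      calc (ℓ : ℝ) ^ ((1 : ℝ) / 3) ≤ ((2 * (t : ℝ)) ^ (3 : ℕ)) ^ ((1 : ℝ) / 3) :=
            Real.rpow_le_rpow (by positivity) hb' (by norm_num)
        _ = 2 * t := by
          rw [← Real.rpow_natCast, ← Real.rpow_mul (by positivity)]
          norm_num
    have : (Fintype.card (V ℓ) : ℝ) < ((ℓ + t : ℕ) : ℝ) := by push_cast; linarith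
    exact le_of_lt (by exact_mod_cast this)
  obtain ⟨A, C, φ, hφ, h1, h2⟩ :=
    aux_chain V inst G hcyc hmono (4 * t ^ 3) (by omega) (4 * t ^ 3)
  obtain ⟨p, hp⟩ : ∃ p, 4 * t ^ 3 + 4 * t ^ 3 = p + 3 := ⟨4 * t ^ 3 + 4 * t ^ 3 - 3, by omega⟩
  have hc : Fintype.card (V (4 * t ^ 3 + 4 * t ^ 3)) ≤ p + 3 + t := by
    rw [← hp]; exact hcard _ (by omega) (by omega)
  have h1' : ∀ ℓ, 4 * t ^ 3 ≤ ℓ → ℓ ≤ 4 * t ^ 3 + 4 * t ^ 3 → _ :=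
    fun ℓ a b => And.intro (hcard ℓ a (by omega)) (h1 ℓ a b)
  have hm : 4 * t ^ 3 ≤ 4 * t ^ 3 + 4 * t ^ 3 := by omega
  have hm2 : 4 * t ^ 3 + 4 * t ^ 3 = 8 * t ^ 3 := by omega
  clear h1 hcard
  generalize 4 * t ^ 3 + 4 * t ^ 3 = m at *
  subst hp
  have := aux_count_s16 (G (p + 3)) (4 * t ^ 3) p t hm (by omega) A C φ hφ
    (fun ℓ a b => by
      obtain ⟨e0, e1, e2, e3, e4⟩ := h1' ℓ a b
      exact ⟨e1, e2, e3 ▸ e0, e4⟩) h2 hc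
  rw [hm2] at this
  nlinarith [Nat.mul_le_mul ht3 (le_refl (t * t)), Nat.mul_le_mul ht3 (le_refl t)]
end

section
/- Let a_1 ≤ a_2 ≤ … ≤ a_n be integers such that a_1 = 1 and a_{i+1} ≤ 2·a_i for each i = 1,…,n−1, and let A = a_1 + a_2 + … + a_n. Then for every integer x with 0 ≤ x ≤ A there exists a subset S ⊆ {1,…,n} such that x = Σ_{s ∈ S} a_s. -/
/-- Let `a 1 ≤ a 2 ≤ … ≤ a n` be integers with `a 1 = 1` and
`a (i+1) ≤ 2 · a i` for `1 ≤ i ≤ n − 1`, and let `A = a 1 + … + a n`. Then every integer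
`0 ≤ x ≤ A` is the sum of the `a s` over some subset `S ⊆ {1, …, n}`. -/
theorem statement17 (n : ℕ) (hn : 1 ≤ n) (a : ℕ → ℤ)
    (hmono : ∀ i : ℕ, 1 ≤ i → i < n → a i ≤ a (i + 1))
    (h1 : a 1 = 1)
    (hdouble : ∀ i : ℕ, 1 ≤ i → i < n → a (i + 1) ≤ 2 * a i)
    (x : ℤ) (hx0 : 0 ≤ x) (hxA : x ≤ ∑ i ∈ Finset.Icc 1 n, a i) :
    ∃ S ⊆ Finset.Icc 1 n, x = ∑ s ∈ S, a s := by
  have key : ∀ m : ℕ, 1 ≤ m → m ≤ n →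
      2 * a m ≤ 1 + ∑ i ∈ Finset.Icc 1 m, a i ∧
      ∀ y : ℤ, 0 ≤ y → y ≤ ∑ i ∈ Finset.Icc 1 m, a i →
        ∃ S ⊆ Finset.Icc 1 m, y = ∑ s ∈ S, a s := by
    intro m hm
    induction m, hm using Nat.le_induction with
    | base =>
      intro _
      refine ⟨by simp [h1], ?_⟩
      intro y hy0 hy1
      simp only [Finset.Icc_self, Finset.sum_singleton, h1] at hy1
      rcases (by omega : y = 0 ∨ y = 1) with h | h
      · exact ⟨∅, by simp, by simp [h]⟩
      · exact ⟨{1}, by simp, by simp [h, h1]⟩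
    | succ m hm ih =>
      intro hmn
      obtain ⟨ih1, ih2⟩ := ih (by omega)
      have hd := hdouble m hm (by omega)
      have hs : ∑ i ∈ Finset.Icc 1 (m + 1), a i = ∑ i ∈ Finset.Icc 1 m, a i + a (m + 1) :=
        Finset.sum_Icc_succ_top (by omega) a
      have hsub : Finset.Icc 1 m ⊆ Finset.Icc 1 (m + 1) :=
        Finset.Icc_subset_Icc_right (by omega)
      rw [hs]
      refine ⟨by linarith, ?_⟩
      intro y hy0 hy1
      by_cases hy : y ≤ ∑ i ∈ Finset.Icc 1 m, a i
      · obtain ⟨S, hS, e⟩ := ih2 y hy0 hy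
        exact ⟨S, hS.trans hsub, e⟩
      · obtain ⟨S, hS, e⟩ := ih2 (y - a (m + 1)) (by omega) (by linarith)
        have hnot : m + 1 ∉ S := by
          intro h
          have := Finset.mem_Icc.1 (hS h)
          omega
        refine ⟨insert (m + 1) S, ?_, ?_⟩
        · exact Finset.insert_subset (Finset.mem_Icc.2 ⟨by omega, le_rfl⟩) (hS.trans hsub)
        · rw [Finset.sum_insert hnot, ← e]
          ring
  exact (key n hn le_rfl).2 x hx0 hxA
end

section
/- There exists a constant C > 0 such that for every n ≥ 3 there exists a simple graph G_n with at most n + log n + C vertices (as a real number, log denoting logarithm base 2) such that for every ℓ with 3 ≤ ℓ ≤ n, the cycle graph C_ℓ is an induced subgraph of G_n. -/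
namespace CycU

def q (j : ℕ) : ℕ := 2 * j + (2 ^ j - 1)

lemma q_zero : q 0 = 0 := by simp [q]

lemma q_succ (j : ℕ) : q (j + 1) + 2 * j = 2 * q j + 3 := by
  have := Nat.one_le_two_pow (n := j)
  simp only [q, pow_succ]; omega

lemma q_ge (j : ℕ) : 2 * j ≤ q j := by simp [q]

lemma q_mono : StrictMono q := by
  apply strictMono_nat_of_lt_succ
  intro j
  have := q_succ j
  have := q_ge j
  omega

/-- path edges and shortcuts -/
def R0 (N a b : ℕ) : Prop :=
  (b < N ∧ b = a + 1) ∨ ∃ j, b = N + j ∧ (a = q j ∨ a = q (j + 1))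

def S0 (N a b : ℕ) : Prop := R0 N a b ∨ R0 N b a

structure P (N k e L : ℕ) (f : ℕ → ℕ) : Prop where
  h0 : f 0 = 0
  hL : f L = e
  hq : q k ≤ e
  he : e < N
  hr : ∀ i ≤ L, f i ≤ e ∨ (N ≤ f i ∧ f i < N + k)
  ha : ∀ i j, i < j → j ≤ L → f i ≠ f j ∧ (S0 N (f i) (f j) ↔ j = i + 1)

lemma P.step {N k e L : ℕ} {f : ℕ → ℕ} (h : P N k e L f) (he : e + 1 < N) :
    ∃ g, P N k (e + 1) (L + 1) g := by
  refine ⟨fun i => if i ≤ L then f i else e + 1, ?_, ?_, ?_, he, ?_, ?_⟩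
  · simp [h.h0]
  · simp
  · have := h.hq; omega
  · intro i hi
    by_cases hiL : i ≤ L
    · have := h.hr i hiL
      simp only [hiL, if_true]; omega
    · simp [hiL]
  · intro i j hij hj
    by_cases hjL : j ≤ L
    · have hiL : i ≤ L := by omega
      simp only [hjL, hiL, if_true]
      exact h.ha i j hij hjL
    · have hiL : i ≤ L := by omega
      simp only [hjL, hiL, if_true, if_false]
      have h1 := h.hr i hiL
      refine ⟨by omega, ?_⟩
      have hj' : j = L + 1 := by omega
      subst hj'
      constructor
      · intro hS
        have hfi : f i = e := by
          rcases hS with (⟨h2, h3⟩ | ⟨j', h3, h4⟩) | (⟨h2, h3⟩ | ⟨j', h3, h4⟩)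
          · omega
          · omega
          · omega
          · exfalso
            have h5 : j' < k := by omega
            have h6 : q j' ≤ q k := q_mono.monotone (by omega)
            have h7 : q (j' + 1) ≤ q k := q_mono.monotone (by omega)
            have := h.hq
            omega
        by_contra hne
        have h8 := (h.ha i L (by omega) le_rfl).1
        rw [h.hL] at h8
        exact h8 hfi
      · intro hi
        have : i = L := by omega
        subst this
        rw [h.hL]
        exact Or.inl (Or.inl ⟨he, rfl⟩)

lemma P.steps {N k e L : ℕ} {f : ℕ → ℕ} (h : P N k e L f) (t : ℕ) (he : e + t < N) :
    ∃ g, P N k (e + t) (L + t) g := by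
  induction t with
  | zero => exact ⟨f, h⟩
  | succ t ih =>
    obtain ⟨g, hg⟩ := ih (by omega)
    exact hg.step (by omega)

lemma P.up {N k e L : ℕ} {f : ℕ → ℕ} (h : P N k e L f) (he : q (k + 1) ≤ e) :
    P N (k + 1) e L f :=
  ⟨h.h0, h.hL, he, h.he, fun i hi => by have := h.hr i hi; omega, h.ha⟩

lemma P.short {N k L : ℕ} {f : ℕ → ℕ} (h : P N k (q k) L f) (he : q (k + 1) < N) :
    ∃ g, P N (k + 1) (q (k + 1)) (L + 2) g := by
  have hqs := q_succ k
  have hqg := q_ge k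
  have hqlt : q k + 2 ≤ q (k + 1) := by omega
  have hlast : ∀ i < L, f i ≠ q k := fun i hi => by
    have := (h.ha i L hi le_rfl).1
    rwa [h.hL] at this
  refine ⟨fun i => if i ≤ L then f i else if i = L + 1 then N + k else q (k + 1),
    ?_, ?_, le_rfl, he, ?_, ?_⟩
  · simp [h.h0]
  · simp
  · intro i hi
    by_cases hiL : i ≤ L
    · have := h.hr i hiL
      simp only [hiL, if_true]; omega
    · simp only [hiL, if_false]
      split_ifs <;> omega
  · intro i j hij hj
    by_cases hjL : j ≤ L
    · have hiL : i ≤ L := by omega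
      simp only [hjL, hiL, if_true]
      exact h.ha i j hij hjL
    by_cases hj1 : j = L + 1
    · have hiL : i ≤ L := by omega
      simp only [hjL, hiL, if_true, if_false, hj1]
      have h1 := h.hr i hiL
      simp only [show ¬ (L + 1 ≤ L) by omega, if_false]
      refine ⟨by omega, ?_⟩
      constructor
      · intro hS
        have hfi : f i = q k := by
          rcases hS with (⟨h2, h3⟩ | ⟨j', h3, h4⟩) | (⟨h2, h3⟩ | ⟨j', h3, h4⟩)
          · omega
          · have : j' = k := by omega
            subst this
            omega
          · omega
          · exfalso
            have h5 : j' < k := by omega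
            have h6 : q j' ≤ q k := q_mono.monotone (by omega)
            have h7 : q (j' + 1) ≤ q k := q_mono.monotone (by omega)
            omega
        by_contra hne
        exact hlast i (by omega) hfi
      · intro hi
        have : i = L := by omega
        subst this
        rw [h.hL]
        exact Or.inl (Or.inr ⟨k, rfl, Or.inl rfl⟩)
    · have hj2 : j = L + 2 := by omega
      subst hj2
      simp only [show ¬ (L + 2 ≤ L) by omega, show ¬ (L + 2 = L + 1) by omega, if_false]
      by_cases hiL : i ≤ L
      · have h1 := h.hr i hiL
        simp only [hiL, if_true]
        refine ⟨by omega, ⟨fun hS => ?_, by omega⟩⟩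
        exfalso
        rcases hS with (⟨h2, h3⟩ | ⟨j', h3, h4⟩) | (⟨h2, h3⟩ | ⟨j', h3, h4⟩)
        · omega
        · omega
        · omega
        · have h5 : j' < k := by omega
          have h6 : q j' ≤ q k := q_mono.monotone (by omega)
          have h7 : q (j' + 1) ≤ q k := q_mono.monotone (by omega)
          omega
      · have hi1 : i = L + 1 := by omega
        subst hi1
        simp only [show ¬ (L + 1 ≤ L) by omega, if_false, if_true]
        refine ⟨by omega, ⟨fun _ => trivial, fun _ => ?_⟩⟩
        exact Or.inr (Or.inr ⟨k, rfl, Or.inr rfl⟩)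

lemma exists_path (N k : ℕ) (hN : q k < N) (L : ℕ) (h1 : 2 * k ≤ L) (h2 : L ≤ q k) :
    ∃ f, P N k (q k) L f := by
  induction k generalizing L with
  | zero =>
    have : L = 0 := by rw [q_zero] at h2; omega
    subst this
    exact ⟨fun _ => 0, rfl, q_zero.symm, le_rfl, hN, fun i _ => by simp, by intros; omega⟩
  | succ k ih =>
    have hqs := q_succ k
    have hqg := q_ge k
    by_cases hL : L ≤ q k + 2
    · obtain ⟨f, hf⟩ := ih (by omega) (L - 2) (by omega) (by omega)
      obtain ⟨g, hg⟩ := hf.short hN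
      rw [show L - 2 + 2 = L by omega] at hg
      exact ⟨g, hg⟩
    · obtain ⟨f, hf⟩ := ih (by omega) (L - (q (k + 1) - q k)) (by omega) (by omega)
      obtain ⟨g, hg⟩ := hf.steps (q (k + 1) - q k) (by omega)
      rw [show L - (q (k + 1) - q k) + (q (k + 1) - q k) = L by omega,
        show q k + (q (k + 1) - q k) = q (k + 1) by omega] at hg
      exact ⟨g, hg.up le_rfl⟩

/-- the full relation -/
def R (n k a b : ℕ) : Prop :=
  (b < n + k ∧ R0 n a b) ∨ (a = 0 ∧ b + 1 = n) ∨ (b = n + k ∧ (a = 0 ∨ a = q k)) ∨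
    (b = n + k + 1 ∧ a < n ∧ ∃ j, a = j * (j + 1) / 2)

def G (n k : ℕ) : SimpleGraph (Fin (n + k + 2)) :=
  SimpleGraph.fromRel (fun a b => R n k a.val b.val)

lemma embed (n k l : ℕ) (hl : 3 ≤ l) (f : ℕ → ℕ) (hb : ∀ i < l, f i < n + k + 2)
    (h : ∀ i j, i < j → j < l → f i ≠ f j ∧
      ((R n k (f i) (f j) ∨ R n k (f j) (f i)) ↔ (j = i + 1 ∨ (i = 0 ∧ j + 1 = l)))) :
    Nonempty (SimpleGraph.cycleGraph l ↪g G n k) := by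
  have inj : ∀ i j, i < l → j < l → f i = f j → i = j := by
    intro i j hi hj hij
    rcases lt_trichotomy i j with h1 | h1 | h1
    · exact absurd hij (h i j h1 hj).1
    · exact h1
    · exact absurd hij.symm (h j i h1 hi).1
  refine ⟨⟨⟨fun i => ⟨f i, hb i i.2⟩, ?_⟩, ?_⟩⟩
  · intro i j hij
    exact Fin.ext (inj i j i.2 j.2 (by simpa using hij))
  · intro i j
    have key : ∀ i j : Fin l, i < j → ((G n k).Adj ⟨f i, hb i i.2⟩ ⟨f j, hb j j.2⟩ ↔
        (SimpleGraph.cycleGraph l).Adj i j) := by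
      intro i j hij
      have h1 := h i j hij j.2
      rw [SimpleGraph.cycleGraph_adj']
      have e1 : (j - i).val = j.val - i.val := Fin.sub_val_of_le hij.le
      have e2 : (i - j).val = l + i.val - j.val := by
        rw [Fin.val_sub, Nat.mod_eq_of_lt] <;> omega
      rw [e1, e2]
      simp only [G, SimpleGraph.fromRel_adj, ne_eq, Fin.mk.injEq, h1.1, not_false_eq_true,
        true_and, h1.2]
      have : i.val < j.val := hij
      omega
    rcases lt_trichotomy i j with h1 | h1 | h1
    · exact key i j h1
    · subst h1; simp
    · rw [SimpleGraph.adj_comm, SimpleGraph.adj_comm _ i j]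
      exact key j i h1

lemma cyc_tail (n k l : ℕ) (hl : 3 ≤ l) (hk : q k < n) (h1 : 2 * k + n ≤ l + q k)
    (h2 : l ≤ n) : Nonempty (SimpleGraph.cycleGraph l ↪g G n k) := by
  obtain ⟨f, hf⟩ := exists_path n k hk (l + q k - n) (by omega) (by omega)
  obtain ⟨g, hg⟩ := hf.steps (n - 1 - q k) (by omega)
  rw [show l + q k - n + (n - 1 - q k) = l - 1 by omega,
    show q k + (n - 1 - q k) = n - 1 by omega] at hg
  have z0 : ∀ i, 0 < i → i < l → g i ≠ 0 := by
    intro i hi hil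
    have := (hg.ha 0 i hi (by omega)).1
    rw [hg.h0] at this; exact this.symm
  have zl : ∀ i, i + 1 < l → g i ≠ n - 1 := by
    intro i hi
    have := (hg.ha i (l - 1) (by omega) (by omega)).1
    rwa [hg.hL] at this
  apply embed n k l hl g
  · intro i hi
    have := hg.hr i (by omega)
    omega
  · intro i j hij hj
    have a1 := hg.ha i j hij (by omega)
    refine ⟨a1.1, ?_⟩
    have ri := hg.hr i (by omega)
    have rj := hg.hr j (by omega)
    have bi : g i < n + k := by omega
    have bj : g j < n + k := by omega
    have b1 : g i ≠ n + k := by omega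
    have b2 : g i ≠ n + k + 1 := by omega
    have b3 : g j ≠ n + k := by omega
    have b4 : g j ≠ n + k + 1 := by omega
    simp only [R, bi, bj, b1, b2, b3, b4, true_and, false_and, or_false]
    rw [← a1.2, S0]
    have c1 : (g i = 0 ∧ g j + 1 = n) ↔ (i = 0 ∧ j + 1 = l) := by
      constructor
      · rintro ⟨u, v⟩
        constructor
        · by_contra hne; exact z0 i (by omega) (by omega) u
        · by_contra hne; exact zl j (by omega) (by omega)
      · rintro ⟨rfl, v⟩
        have : j = l - 1 := by omega
        subst this
        rw [hg.h0, hg.hL]; omega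
    have c2 : ¬ (g j = 0 ∧ g i + 1 = n) := by
      rintro ⟨u, v⟩; exact z0 j (by omega) hj u
    rw [c1]
    simp only [c2, or_false]
    exact or_right_comm

lemma cyc_z (n k l : ℕ) (hl : 3 ≤ l) (hk : q k + 1 < n) (h1 : 2 * k + 2 ≤ l)
    (h2 : l ≤ q k + 2) : Nonempty (SimpleGraph.cycleGraph l ↪g G n k) := by
  obtain ⟨g, hg⟩ := exists_path n k (by omega) (l - 2) (by omega) (by omega)
  have z0 : ∀ i, 0 < i → i + 1 < l → g i ≠ 0 := by
    intro i hi hil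
    have := (hg.ha 0 i hi (by omega)).1
    rw [hg.h0] at this; exact this.symm
  have zl : ∀ i, i + 2 < l → g i ≠ q k := by
    intro i hi
    have := (hg.ha i (l - 2) (by omega) (by omega)).1
    rwa [hg.hL] at this
  apply embed n k l hl (fun i => if i + 1 < l then g i else n + k)
  · intro i hi
    split_ifs with h
    · have := hg.hr i (by omega)
      omega
    · omega
  · intro i j hij hj
    have hi : i + 1 < l := by omega
    have ri := hg.hr i (by omega)
    by_cases hj' : j + 1 < l
    · simp only [hi, hj', if_true]
      have a1 := hg.ha i j hij (by omega)
      refine ⟨a1.1, ?_⟩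
      have rj := hg.hr j (by omega)
      have bi : g i < n + k := by omega
      have bj : g j < n + k := by omega
      have b1 : g i ≠ n + k := by omega
      have b2 : g i ≠ n + k + 1 := by omega
      have b3 : g j ≠ n + k := by omega
      have b4 : g j ≠ n + k + 1 := by omega
      have b5 : g i + 1 ≠ n := by omega
      have b6 : g j + 1 ≠ n := by omega
      have b7 : j + 1 ≠ l := by omega
      simp only [R, bi, bj, b1, b2, b3, b4, b5, b6, b7, true_and, false_and, and_false, or_false]
      rw [← a1.2, S0]
    · simp only [hi, hj', if_true, if_false]
      refine ⟨by omega, ?_⟩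
      have n1 : ¬ R n k (n + k) (g i) := by
        rintro (⟨_, (⟨u, v⟩ | ⟨j', u, v⟩)⟩ | ⟨u, v⟩ | ⟨u, v⟩ | ⟨u, v, w⟩)
        · omega
        · have h6 : q j' ≤ q k := q_mono.monotone (by omega)
          have h7 : q (j' + 1) ≤ q k := q_mono.monotone (by omega)
          omega
        · omega
        · omega
        · omega
      have n2 : R n k (g i) (n + k) ↔ (g i = 0 ∨ g i = q k) := by
        constructor
        · rintro (⟨u, _⟩ | ⟨u, v⟩ | ⟨u, v⟩ | ⟨u, v, w⟩)
          · omega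
          · omega
          · exact v
          · omega
        · intro h
          exact Or.inr (Or.inr (Or.inl ⟨rfl, h⟩))
      simp only [n1, n2, or_false]
      constructor
      · rintro (u | u)
        · right
          refine ⟨?_, by omega⟩
          by_contra hne; exact z0 i (by omega) hi u
        · left
          by_contra hne; exact zl i (by omega) u
      · rintro (u | ⟨rfl, v⟩)
        · right
          have : i = l - 2 := by omega
          subst this
          exact hg.hL
        · left; exact hg.h0

lemma tri_succ (j : ℕ) : (j + 1) * (j + 1 + 1) / 2 = j * (j + 1) / 2 + (j + 1) := by
  rw [show (j + 1) * (j + 1 + 1) = j * (j + 1) + (j + 1) * 2 by ring]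
  omega

lemma tri_mono : StrictMono (fun j : ℕ => j * (j + 1) / 2) := by
  apply strictMono_nat_of_lt_succ
  intro j
  rw [tri_succ]; omega

/-- cycles through the apex: `l = m + 3`, using positions `T m .. T (m+1)`. -/
lemma cyc_apex (n k m : ℕ) (hm : (m + 1) * (m + 1 + 1) / 2 + 1 < n) :
    Nonempty (SimpleGraph.cycleGraph (m + 3) ↪g G n k) := by
  have ts := tri_succ m
  set T := m * (m + 1) / 2 with hT
  apply embed n k (m + 3) (by omega) (fun i => if i < m + 2 then T + i else n + k + 1)
  · intro i hi
    split_ifs <;> omega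
  · intro i j hij hj
    have hi : i < m + 2 := by omega
    by_cases hj' : j < m + 2
    · simp only [hi, hj', if_true]
      refine ⟨by omega, ?_⟩
      constructor
      · rintro ((⟨_, (⟨u, v⟩ | ⟨j', u, v⟩)⟩ | ⟨u, v⟩ | ⟨u, v⟩ | ⟨u, v, w⟩) |
          (⟨_, (⟨u, v⟩ | ⟨j', u, v⟩)⟩ | ⟨u, v⟩ | ⟨u, v⟩ | ⟨u, v, w⟩)) <;> omega
      · rintro (u | u)
        · left; left
          exact ⟨by omega, Or.inl (by omega)⟩
        · omega
    · simp only [hi, hj', if_true, if_false]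
      refine ⟨by omega, ?_⟩
      constructor
      · rintro ((⟨_, (⟨u, v⟩ | ⟨j', u, v⟩)⟩ | ⟨u, v⟩ | ⟨u, v⟩ | ⟨u, v, ⟨j', w⟩⟩) |
          (⟨_, (⟨u, v⟩ | ⟨j', u, v⟩)⟩ | ⟨u, v⟩ | ⟨u, v⟩ | ⟨u, v, w⟩))
        any_goals omega
        rcases lt_or_ge j' m with h | h
        · have := tri_mono h
          dsimp only at this
          omega
        rcases lt_or_ge (m + 1) j' with h' | h'
        · have := tri_mono h'
          dsimp only at this
          omega
        have : j' = m ∨ j' = m + 1 := by omega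
        rcases this with rfl | rfl <;> omega
      · intro h
        left; right; right; right
        refine ⟨rfl, by omega, ?_⟩
        have : i = 0 ∨ i = m + 1 := by omega
        rcases this with rfl | rfl
        · exact ⟨m, by omega⟩
        · exact ⟨m + 1, by omega⟩

lemma quad (k : ℕ) (hk : 6 ≤ k) : 2 * (k * k) + 2 ≤ 2 ^ k + 3 * k := by
  induction k, hk using Nat.le_induction with
  | base => norm_num
  | succ k hk ih =>
    rw [pow_succ]
    nlinarith

lemma exists_k (n : ℕ) (hn : 1 ≤ n) : ∃ k, q k < n ∧ n ≤ q (k + 1) := by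
  induction n, hn using Nat.le_induction with
  | base => exact ⟨0, by simp [q], by simp [q]⟩
  | succ n hn ih =>
    obtain ⟨k, h1, h2⟩ := ih
    by_cases h : n + 1 ≤ q (k + 1)
    · exact ⟨k, by omega, h⟩
    · have := q_mono (show k + 1 < k + 1 + 1 by omega)
      exact ⟨k + 1, by omega, by omega⟩

lemma small : ∃ (V : Type) (_ : Fintype V) (G : SimpleGraph V),
    ∀ l : ℕ, l < 80 → Nonempty (SimpleGraph.cycleGraph l ↪g G) := by
  refine ⟨Σ l : Fin 80, Fin l.val, inferInstance,
    ⟨fun a b => ∃ h : a.1 = b.1, (SimpleGraph.cycleGraph b.1.val).Adj (h ▸ a.2) b.2, ?_, ?_⟩, ?_⟩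
  · constructor
    rintro ⟨a, x⟩ ⟨b, y⟩ ⟨h, h'⟩
    dsimp only at h
    subst h
    exact ⟨rfl, h'.symm⟩
  · constructor
    rintro ⟨a, x⟩ ⟨h, h'⟩
    exact (SimpleGraph.irrefl _) h'
  · intro l hl
    refine ⟨⟨⟨fun i => ⟨⟨l, hl⟩, i⟩, ?_⟩, ?_⟩⟩
    · intro i j hij
      simpa using hij
    · intro i j
      exact ⟨fun ⟨_, h⟩ => h, fun h => ⟨rfl, h⟩⟩

end CycU

open CycU in
/-- There is a constant `C > 0` such that for every `n ≥ 3` there is a graph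
with at most `n + log n + C` vertices (logarithm base 2) containing, for each `3 ≤ ℓ ≤ n`, the
cycle of length `ℓ` as an induced subgraph. -/
theorem statement18 :
    ∃ C : ℝ, 0 < C ∧ ∀ n : ℕ, 3 ≤ n →
      ∃ (V : Type) (_ : Fintype V) (G : SimpleGraph V),
        (Fintype.card V : ℝ) ≤ (n : ℝ) + Real.logb 2 n + C ∧
        ∀ ℓ : ℕ, 3 ≤ ℓ → ℓ ≤ n → Nonempty (SimpleGraph.cycleGraph ℓ ↪g G) := by
  obtain ⟨V, iV, H, hH⟩ := small
  refine ⟨(Fintype.card V : ℝ) + 2, by positivity, ?_⟩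
  intro n hn
  have hlog : 0 ≤ Real.logb 2 n :=
    Real.logb_nonneg (by norm_num) (by exact_mod_cast (by omega : 1 ≤ n))
  by_cases hs : n < 80
  · refine ⟨V, iV, H, ?_, fun l _ hl => hH l (by omega)⟩
    have : (0 : ℝ) ≤ n := by positivity
    linarith
  obtain ⟨k, hk1, hk2⟩ := exists_k n (by omega)
  have hk6 : 6 ≤ k := by
    by_contra h
    have : q (k + 1) ≤ q 6 := q_mono.monotone (by omega)
    have : q 6 = 75 := by norm_num [q]
    omega
  have hqd : q k + 1 = 2 * k + 2 ^ k := by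
    have := Nat.one_le_two_pow (n := k)
    simp only [q]; omega
  have hqs := q_succ k
  refine ⟨Fin (n + k + 2), inferInstance, CycU.G n k, ?_, ?_⟩
  · have hkl : (k : ℝ) ≤ Real.logb 2 n := by
      rw [Real.le_logb_iff_rpow_le (by norm_num) (by positivity), Real.rpow_natCast]
      exact_mod_cast (by omega : 2 ^ k ≤ n)
    have : (0 : ℝ) ≤ Fintype.card V := by positivity
    simp only [Fintype.card_fin]
    push_cast
    linarith
  · intro l hl hln
    by_cases c1 : 2 * k + n ≤ l + q k
    · exact cyc_tail n k l hl hk1 c1 hln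
    by_cases c2 : 2 * k + 2 ≤ l
    · exact cyc_z n k l hl (by omega) c2 (by omega)
    · obtain ⟨m, rfl⟩ : ∃ m, l = m + 3 := ⟨l - 3, by omega⟩
      apply cyc_apex
      have hq := quad k hk6
      have hm : (m + 1) * (m + 1 + 1) ≤ (2 * k - 1) * (2 * k) :=
        Nat.mul_le_mul (by omega) (by omega)
      obtain ⟨c, rfl⟩ : ∃ c, k = c + 1 := ⟨k - 1, by omega⟩
      have e : (2 * (c + 1) - 1) * (2 * (c + 1)) = 2 * (2 * ((c + 1) * (c + 1)) - (c + 1)) := by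
        rw [show 2 * (c + 1) - 1 = 2 * c + 1 by omega,
          show 2 * ((c + 1) * (c + 1)) - (c + 1) = (2 * c + 1) * (c + 1) by
            rw [show 2 * ((c + 1) * (c + 1)) = (2 * c + 1) * (c + 1) + (c + 1) by ring]; omega]
        ring
      omega
end

section
/- There exist a constant C > 0 and an infinite family of simple graphs G_3, G_4, G_5, … such that for every n ≥ 3: (i) for every ℓ with 3 ≤ ℓ ≤ n, the cycle graph C_ℓ is an induced subgraph of G_n; (ii) G_n is an induced subgraph of G_{n+1}; and (iii) G_n has at most n + C·√n vertices (as a real number). -/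
def ugRel (a b : ℤ × ℕ) : Prop :=
  (a.2 = 0 ∧ b.2 = 0 ∧ b.1 = a.1 + 1) ∨ (a.2 = 0 ∧ b.2 = 1 ∧ a.1 = -b.1) ∨
  (a.2 = 0 ∧ b.2 = 2 ∧ a.1 = b.1 ^ 2) ∨ (a.2 = 1 ∧ b.2 = 2)

def ugU : SimpleGraph (ℤ × ℕ) := SimpleGraph.fromRel ugRel

noncomputable def ugS (n : ℕ) : Finset (ℤ × ℕ) :=
  (Finset.Icc (-(2 * (n.sqrt : ℤ))) (n : ℤ) ×ˢ {0}) ∪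
  ((Finset.Icc (0 : ℤ) (2 * (n.sqrt : ℤ)) ×ˢ {1}) ∪
  (Finset.Icc (0 : ℤ) (n.sqrt : ℤ) ×ˢ {2}))

theorem mem_ugS (n : ℕ) (a : ℤ) (b : ℕ) : (a, b) ∈ ugS n ↔
    (-(2 * (n.sqrt : ℤ)) ≤ a ∧ a ≤ n ∧ b = 0) ∨ (0 ≤ a ∧ a ≤ 2 * (n.sqrt : ℤ) ∧ b = 1) ∨
    (0 ≤ a ∧ a ≤ (n.sqrt : ℤ) ∧ b = 2) := by
  simp [ugS, and_assoc, eq_comm (a := b)]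

theorem ugS_card (n : ℕ) : (ugS n).card ≤ n + 5 * n.sqrt + 3 := by
  unfold ugS
  refine (Finset.card_union_le _ _).trans ?_
  refine (Nat.add_le_add_left (Finset.card_union_le _ _) _).trans ?_
  simp only [Finset.card_product, Int.card_Icc, Finset.card_singleton]
  omega

theorem ugS_mono (n : ℕ) : ugS n ⊆ ugS (n + 1) := by
  rintro ⟨a, b⟩ h
  rw [mem_ugS] at *
  have : n.sqrt ≤ (n + 1).sqrt := Nat.sqrt_le_sqrt (Nat.le_succ n)
  push_cast
  omega

theorem ug_fin_sub {l : ℕ} (hl : 3 ≤ l) (u v : Fin l) :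
    (u - v).val = 1 ↔ (u.val = v.val + 1 ∨ (u.val = 0 ∧ v.val = l - 1)) := by
  have hu := u.isLt
  have hv := v.isLt
  rcases le_or_gt v u with h | h
  · rw [Fin.sub_val_of_le h]
    have : v.val ≤ u.val := h
    omega
  · have : u.val < v.val := h
    rw [Fin.coe_sub_iff_lt.2 h]
    omega

def ugF (d i j k : ℕ) : ℤ × ℕ :=
  if k ≤ d then ((k : ℤ) - i, 0) else if k = d + 1 then ((j : ℤ), 2) else ((i : ℤ), 1)

theorem ugF_inj {d i j k k' : ℕ} (hk : k < d + 3) (hk' : k' < d + 3)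
    (h : ugF d i j k = ugF d i j k') : k = k' := by
  unfold ugF at h
  split_ifs at h <;> simp only [Prod.mk.injEq] at h <;> omega

theorem ugF_rel {d i j k k' : ℕ} (hd : d = j * j + i) (hk : k < d + 3) (hk' : k' < d + 3) :
    ugRel (ugF d i j k) (ugF d i j k') ↔ ((k ≤ d ∧ k' = k + 1) ∨ (k = 0 ∧ k' = d + 2) ∨
      (k = d + 2 ∧ k' = d + 1)) := by
  have hd' : (d : ℤ) = (j : ℤ) ^ 2 + i := by rw [hd]; push_cast; ring
  unfold ugF ugRel
  split_ifs <;> simp <;> omega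

theorem ug_cycle (n l : ℕ) (h3 : 3 ≤ l) (hl : l ≤ n) :
    Nonempty (SimpleGraph.cycleGraph l ↪g ugU.induce (ugS n : Set (ℤ × ℕ))) := by
  obtain ⟨d, rfl⟩ : ∃ d, l = d + 3 := ⟨l - 3, by omega⟩
  obtain ⟨i, hi⟩ : ∃ i, d = d.sqrt * d.sqrt + i := Nat.exists_eq_add_of_le (Nat.sqrt_le d)
  have h1 : d.sqrt ≤ n.sqrt := Nat.sqrt_le_sqrt (by omega)
  have h2 : d ≤ d.sqrt * d.sqrt + d.sqrt + d.sqrt := Nat.sqrt_le_add d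
  have hmem : ∀ k : Fin (d + 3), ugF d i d.sqrt k ∈ (ugS n : Set (ℤ × ℕ)) := by
    intro k
    rw [Finset.mem_coe]
    unfold ugF
    split_ifs <;> rw [mem_ugS] <;> omega
  refine ⟨⟨⟨fun k => ⟨ugF d i d.sqrt k, hmem k⟩, ?_⟩, ?_⟩⟩
  · intro a b h
    exact Fin.ext (ugF_inj a.isLt b.isLt (Subtype.ext_iff.1 h))
  · intro a b
    have ha := a.isLt
    have hb := b.isLt
    change (ugF d i d.sqrt a ≠ ugF d i d.sqrt b ∧ (ugRel (ugF d i d.sqrt a) (ugF d i d.sqrt b) ∨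
      ugRel (ugF d i d.sqrt b) (ugF d i d.sqrt a))) ↔ _
    rw [SimpleGraph.cycleGraph_adj', ug_fin_sub h3, ug_fin_sub h3, ugF_rel hi ha hb,
      ugF_rel hi hb ha]
    constructor
    · rintro ⟨-, h⟩
      omega
    · intro h
      refine ⟨fun e => ?_, by omega⟩
      have := ugF_inj ha hb e
      omega

/-- There are a constant `C > 0` and a family of graphs `G_3, G_4, …` such
that for every `n ≥ 3`: (i) for each `3 ≤ ℓ ≤ n` the cycle of length `ℓ` is an induced
subgraph of `G_n`; (ii) `G_n` is an induced subgraph of `G_{n+1}`; (iii) `G_n` has at most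
`n + C·√n` vertices. -/
theorem statement19 :
    ∃ C : ℝ, 0 < C ∧
      ∃ (V : ℕ → Type) (inst : ∀ n, Fintype (V n)) (G : ∀ n, SimpleGraph (V n)),
        ∀ n : ℕ, 3 ≤ n →
          (∀ ℓ : ℕ, 3 ≤ ℓ → ℓ ≤ n → Nonempty (SimpleGraph.cycleGraph ℓ ↪g G n)) ∧
          Nonempty (G n ↪g G (n + 1)) ∧
          (Fintype.card (V n) : ℝ) ≤ (n : ℝ) + C * Real.sqrt n := by
  refine ⟨8, by norm_num, fun n => (ugS n : Set (ℤ × ℕ)), fun n => inferInstance,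
    fun n => ugU.induce (ugS n : Set (ℤ × ℕ)), fun n hn => ⟨fun l h3 hl => ug_cycle n l h3 hl, ?_, ?_⟩⟩
  · exact ⟨SimpleGraph.induceHomOfLE ugU (Finset.coe_subset.2 (ugS_mono n))⟩
  · have h1 := ugS_card n
    have h2 : (n.sqrt : ℝ) ≤ Real.sqrt n := Real.nat_sqrt_le_real_sqrt
    have h3 : (1 : ℝ) ≤ Real.sqrt n := Real.one_le_sqrt.2 (by exact_mod_cast (by omega : 1 ≤ n))
    have h4 : ((ugS n).card : ℝ) ≤ n + 5 * n.sqrt + 3 := by exact_mod_cast h1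
    have h5 : Fintype.card (ugS n : Set (ℤ × ℕ)) = (ugS n).card := by simp
    rw [h5]
    linarith
end
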